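/- Let r ≥ 4 be an integer, let G be a finite simple graph, and let X, Y be disjoint subsets of V(G) such that: (i) any two distinct non-adjacent vertices that both lie in X have the same neighborhood in G; (ii) any two distinct non-adjacent vertices that both lie in Y have the same neighborhood in G; (iii) the induced subgraph G[X ∪ Y] is K_{r-1}-free; (iv) the induced subgraph G[Y] is K_{r-2}-free; (v) G contains no clique on r-2 vertices having exactly one vertex in X and exactly r-3 vertices in Y. Then there exists a subset S ⊆ X ∪ Y with 2|S| ≥ |X| + 2|Y| such that the induced subgraph G[S] has chromatic number at most r-3. -/

import Mathlib

open SimpleGraph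

/-- A graph covered by two cliques whose cliques have size at most `k` is `k`-colorable (Hall). -/
theorem aux_color {V : Type*} [Fintype V] (G : SimpleGraph V) (P Q : Finset V) (k : ℕ)
    (hP : G.IsClique (P : Set V)) (hQ : G.IsClique (Q : Set V)) (hd : Disjoint P Q)
    (hk : ∀ K : Finset V, (∀ v ∈ K, v ∈ P ∨ v ∈ Q) → G.IsClique (K : Set V) → K.card ≤ k) :
    (G.induce {v | v ∈ P ∨ v ∈ Q}).Colorable k := by
  classical
  have hQk : Q.card ≤ k := hk Q (fun v hv => Or.inr hv) hQ
  let t : P → Finset (Q ⊕ Fin (k - Q.card)) := fun a =>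
    Finset.univ.filter (fun z => ∀ q : Q, z = Sum.inl q → ¬ G.Adj a q)
  have hall : ∀ s : Finset P, s.card ≤ (s.biUnion t).card := by
    intro s
    rcases s.eq_empty_or_nonempty with rfl | ⟨a0, ha0⟩
    · simp
    let N : Finset Q := Finset.univ.filter (fun q => ∃ a ∈ s, ¬ G.Adj a q)
    let M : Finset Q := Finset.univ.filter (fun q => ¬ ∃ a ∈ s, ¬ G.Adj a q)
    have hNM : N.card + M.card = Q.card := by
      have := Finset.card_filter_add_card_filter_not (s := (Finset.univ : Finset Q))
        (fun q => ∃ a ∈ s, ¬ G.Adj a q)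
      simpa [N, M] using this
    have h1 : N.disjSum (Finset.univ : Finset (Fin (k - Q.card))) ⊆ s.biUnion t := by
      intro z hz
      rw [Finset.mem_biUnion]
      rcases z with q | i
      · simp only [Finset.inl_mem_disjSum, N, Finset.mem_filter] at hz
        obtain ⟨-, a, ha, hq⟩ := hz
        refine ⟨a, ha, ?_⟩
        simp only [t, Finset.mem_filter, Finset.mem_univ, true_and]
        intro q' h
        cases h
        exact hq
      · exact ⟨a0, ha0, by simp [t]⟩
    have h2 := Finset.card_le_card h1
    rw [Finset.card_disjSum, Finset.card_univ, Fintype.card_fin] at h2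
    have h3 : (s.map (Function.Embedding.subtype _) ∪
        M.map (Function.Embedding.subtype _)).card ≤ k := by
      apply hk
      · intro v hv
        simp only [Finset.mem_union, Finset.mem_map, Function.Embedding.subtype_apply] at hv
        rcases hv with ⟨a, -, rfl⟩ | ⟨a, -, rfl⟩
        · exact Or.inl a.2
        · exact Or.inr a.2
      · intro u hu v hv huv
        simp only [Finset.coe_union, Finset.coe_map, Function.Embedding.subtype_apply,
          Set.mem_union, Set.mem_image, Finset.mem_coe, M, Finset.mem_filter] at hu hv
        rcases hu with ⟨a, ha, rfl⟩ | ⟨a, ha, rfl⟩ <;> rcases hv with ⟨b, hb, rfl⟩ | ⟨b, hb, rfl⟩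
        · exact hP a.2 b.2 huv
        · by_contra h
          exact hb.2 ⟨a, ha, h⟩
        · by_contra h
          exact ha.2 ⟨b, hb, fun h' => h h'.symm⟩
        · exact hQ a.2 b.2 huv
    rw [Finset.card_union_of_disjoint, Finset.card_map, Finset.card_map] at h3
    · omega
    · rw [Finset.disjoint_left]
      intro v hv hv'
      simp only [Finset.mem_map, Function.Embedding.subtype_apply] at hv hv'
      obtain ⟨a, -, rfl⟩ := hv
      obtain ⟨b, -, hb⟩ := hv'
      exact Finset.disjoint_left.1 hd a.2 (hb ▸ b.2)
  obtain ⟨f, hf, hft⟩ := (Finset.all_card_le_biUnion_card_iff_exists_injective t).1 hall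
  simp only [t, Finset.mem_filter, Finset.mem_univ, true_and] at hft
  let c : {v | v ∈ P ∨ v ∈ Q} → (Q ⊕ Fin (k - Q.card)) := fun v =>
    if h : v.1 ∈ P then f ⟨v.1, h⟩ else Sum.inl ⟨v.1, v.2.resolve_left h⟩
  have hc : ∀ {u v}, (G.induce {v | v ∈ P ∨ v ∈ Q}).Adj u v → c u ≠ c v := by
    intro u v huv
    have huv' : G.Adj u.1 v.1 := huv
    simp only [c]
    split_ifs with h1 h2 h2
    · intro h
      have := hf h
      simp only [Subtype.mk.injEq] at this
      exact huv'.ne this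
    · intro h
      exact hft _ _ h huv'
    · intro h
      exact hft _ _ h.symm huv'.symm
    · intro h
      simp only [Sum.inl.injEq, Subtype.mk.injEq] at h
      exact huv'.ne h
  have := (Coloring.mk c hc).colorable
  rw [Fintype.card_sum, Fintype.card_coe, Fintype.card_fin] at this
  convert this using 1
  omega

/-- Uncrossing: some two vertices of `P` lie in all cliques of size `k+1`. -/
theorem aux_hit {V : Type*} [Fintype V] (G : SimpleGraph V) (P Q : Finset V) (k : ℕ)
    (hP : G.IsClique (P : Set V)) (hQ : G.IsClique (Q : Set V)) (hd : Disjoint P Q)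
    (hk : ∀ K : Finset V, (∀ v ∈ K, v ∈ P ∨ v ∈ Q) → G.IsClique (K : Set V) → K.card ≤ k + 1)
    (h2 : ∀ K : Finset V, (∀ v ∈ K, v ∈ P ∨ v ∈ Q) → G.IsClique (K : Set V) → K.card = k + 1 →
      ∃ a ∈ K, ∃ b ∈ K, a ∈ P ∧ b ∈ P ∧ a ≠ b)
    (hex : ∃ K : Finset V, (∀ v ∈ K, v ∈ P ∨ v ∈ Q) ∧ G.IsClique (K : Set V) ∧ K.card = k + 1) :
    ∃ a ∈ P, ∃ b ∈ P, a ≠ b ∧ ∀ K : Finset V, (∀ v ∈ K, v ∈ P ∨ v ∈ Q) →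
      G.IsClique (K : Set V) → K.card = k + 1 → a ∈ K ∧ b ∈ K := by
  classical
  let F : Finset (Finset V) := Finset.univ.filter (fun K =>
    (∀ v ∈ K, v ∈ P ∨ v ∈ Q) ∧ G.IsClique (K : Set V) ∧ K.card = k + 1)
  obtain ⟨K0, hK0, hmin⟩ := F.exists_min_image (fun K => (K ∩ P).card) (by
    obtain ⟨K, hK⟩ := hex
    exact ⟨K, by simpa [F] using hK⟩)
  simp only [F, Finset.mem_filter, Finset.mem_univ, true_and] at hK0 hmin
  obtain ⟨hs0, hc0, hn0⟩ := hK0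
  have key : ∀ K : Finset V, (∀ v ∈ K, v ∈ P ∨ v ∈ Q) →
      G.IsClique (K : Set V) → K.card = k + 1 → K0 ∩ P ⊆ K := by
    intro K hs hc hn
    have hdis : ∀ v ∈ P, v ∉ Q := fun v hv => Finset.disjoint_left.1 hd hv
    have gen : ∀ P Q : Finset V, (∀ v ∈ K, v ∈ P ∨ v ∈ Q) → (∀ v ∈ K0, v ∈ P ∨ v ∈ Q) →
        G.IsClique (Q : Set V) →
        G.IsClique (((K ∩ K0 ∩ P) ∪ ((K ∪ K0) ∩ Q) : Finset V) : Set V) := by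
      intro P Q hs hs0 hQ u hu v hv huv
      simp only [Finset.coe_union, Finset.coe_inter, Set.mem_union, Set.mem_inter_iff,
        Finset.mem_coe] at hu hv
      rcases hu with ⟨⟨hu1, hu2⟩, hu3⟩ | ⟨hu1, hu2⟩ <;>
        rcases hv with ⟨⟨hv1, hv2⟩, hv3⟩ | ⟨hv1, hv2⟩
      · exact hc hu1 hv1 huv
      · rcases hv1 with hv1 | hv1
        · exact hc hu1 hv1 huv
        · exact hc0 hu2 hv1 huv
      · rcases hu1 with hu1 | hu1
        · exact hc hu1 hv1 huv
        · exact hc0 hu1 hv2 huv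
      · exact hQ hu2 hv2 huv
    have c1 := gen P Q hs hs0 hQ
    have c2 := gen Q P (fun v hv => (hs v hv).symm) (fun v hv => (hs0 v hv).symm) hP
    have s1 : ∀ v ∈ (K ∩ K0 ∩ P) ∪ ((K ∪ K0) ∩ Q), v ∈ P ∨ v ∈ Q := by
      intro v; simp only [Finset.mem_union, Finset.mem_inter]; tauto
    have s2 : ∀ v ∈ (K ∩ K0 ∩ Q) ∪ ((K ∪ K0) ∩ P), v ∈ P ∨ v ∈ Q := by
      intro v; simp only [Finset.mem_union, Finset.mem_inter]; tauto
    have l1 := hk _ s1 c1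
    have l2 := hk _ s2 c2
    have d1 : ((K ∩ K0 ∩ P) ∪ ((K ∪ K0) ∩ Q)).card
        = (K ∩ K0 ∩ P).card + ((K ∪ K0) ∩ Q).card := by
      apply Finset.card_union_of_disjoint
      exact (hd.mono Finset.inter_subset_right Finset.inter_subset_right)
    have d2 : ((K ∩ K0 ∩ Q) ∪ ((K ∪ K0) ∩ P)).card
        = (K ∩ K0 ∩ Q).card + ((K ∪ K0) ∩ P).card := by
      apply Finset.card_union_of_disjoint
      exact (hd.symm.mono Finset.inter_subset_right Finset.inter_subset_right)
    have split : ∀ L : Finset V, (∀ v ∈ L, v ∈ P ∨ v ∈ Q) →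
        L.card = (L ∩ P).card + (L ∩ Q).card := by
      intro L hL
      rw [← Finset.card_union_of_disjoint
        (hd.mono Finset.inter_subset_right Finset.inter_subset_right)]
      congr 1
      ext v
      simp only [Finset.mem_union, Finset.mem_inter]
      have := hL v
      tauto
    have e1 := split (K ∩ K0) (fun v hv => hs v (Finset.mem_inter.1 hv).1)
    have e2 := split (K ∪ K0) (fun v hv => (Finset.mem_union.1 hv).elim (hs v) (hs0 v))
    have e3 := Finset.card_union_add_card_inter K K0
    have hm := hmin _ ⟨s1, c1, by omega⟩
    have e4 : ((K ∩ K0 ∩ P) ∪ ((K ∪ K0) ∩ Q)) ∩ P = K ∩ K0 ∩ P := by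
      ext v
      have := hdis v
      simp only [Finset.mem_union, Finset.mem_inter]
      tauto
    rw [e4] at hm
    have sub : K ∩ K0 ∩ P ⊆ K0 ∩ P :=
      Finset.inter_subset_inter_right Finset.inter_subset_right
    have := Finset.eq_of_subset_of_card_le sub hm
    rw [← this]
    exact Finset.inter_subset_left.trans Finset.inter_subset_left
  obtain ⟨a, ha, b, hb, haP, hbP, hab⟩ := h2 K0 hs0 hc0 hn0
  exact ⟨a, haP, b, hbP, hab, fun K hs hc hn =>
    ⟨key K hs hc hn (Finset.mem_inter.2 ⟨ha, haP⟩), key K hs hc hn (Finset.mem_inter.2 ⟨hb, hbP⟩)⟩⟩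

/-- Representatives of the twin classes. -/
theorem aux_rep {V : Type*} [Fintype V] (G : SimpleGraph V) (X : Set V)
    (hX : ∀ x ∈ X, ∀ x' ∈ X, x ≠ x' → ¬ G.Adj x x' →
      G.neighborSet x = G.neighborSet x') :
    ∃ (P : Finset V) (p : V → V), (∀ v ∈ P, v ∈ X) ∧ G.IsClique (P : Set V) ∧
      (∀ x ∈ X, p x ∈ P) ∧ (∀ x ∈ X, ∀ v, G.Adj x v ↔ G.Adj (p x) v) := by
  classical
  rcases isEmpty_or_nonempty V with hV | hV
  · exact ⟨∅, id, by simp, by simp, fun x => hV.elim x, fun x => hV.elim x⟩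
  let p : V → V := fun x => Function.invFunOn G.neighborSet X (G.neighborSet x)
  have hp1 : ∀ x ∈ X, p x ∈ X := fun x hx => Function.invFunOn_mem ⟨x, hx, rfl⟩
  have hp2 : ∀ x ∈ X, G.neighborSet (p x) = G.neighborSet x :=
    fun x hx => Function.invFunOn_eq (f := G.neighborSet) ⟨x, hx, rfl⟩
  refine ⟨Finset.univ.filter (fun v => ∃ x ∈ X, p x = v), p, ?_, ?_, ?_, ?_⟩
  · intro v hv
    simp only [Finset.mem_filter, Finset.mem_univ, true_and] at hv
    obtain ⟨x, hx, rfl⟩ := hv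
    exact hp1 x hx
  · intro u hu v hv huv
    simp only [Finset.coe_filter, Finset.mem_univ, true_and, Set.mem_ofPred_eq] at hu hv
    obtain ⟨x, hx, rfl⟩ := hu
    obtain ⟨y, hy, rfl⟩ := hv
    by_contra h
    have := hX _ (hp1 x hx) _ (hp1 y hy) huv h
    rw [hp2 x hx, hp2 y hy] at this
    exact huv (by simp only [p, this])
  · intro x hx
    simp only [Finset.mem_filter, Finset.mem_univ, true_and]
    exact ⟨x, hx, rfl⟩
  · intro x hx v
    rw [← mem_neighborSet, ← mem_neighborSet, hp2 x hx]

theorem stmt_12 {V : Type*} [Fintype V] (r : ℕ) (hr : 4 ≤ r) (G : SimpleGraph V)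
    (X Y : Set V) (hXY : Disjoint X Y)
    (hX : ∀ x ∈ X, ∀ x' ∈ X, x ≠ x' → ¬ G.Adj x x' →
      G.neighborSet x = G.neighborSet x')
    (hY : ∀ y ∈ Y, ∀ y' ∈ Y, y ≠ y' → ¬ G.Adj y y' →
      G.neighborSet y = G.neighborSet y')
    (hXYfree : (G.induce (X ∪ Y)).CliqueFree (r - 1))
    (hYfree : (G.induce Y).CliqueFree (r - 2))
    (hXYr : ¬ ∃ K : Finset V, G.IsNClique (r - 2) K ∧ ((K : Set V) ∩ X).ncard = 1 ∧
      ((K : Set V) ∩ Y).ncard = r - 3) :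
    ∃ S ⊆ X ∪ Y, X.ncard + 2 * Y.ncard ≤ 2 * S.ncard ∧
      (G.induce S).chromaticNumber ≤ ((r - 3 : ℕ) : ℕ∞) := by
  classical
  obtain ⟨k, rfl⟩ : ∃ k, r = k + 3 := ⟨r - 3, by omega⟩
  rw [show k + 3 - 1 = k + 2 by omega] at hXYfree
  rw [show k + 3 - 2 = k + 1 by omega] at hYfree hXYr
  rw [show k + 3 - 3 = k by omega] at hXYr ⊢
  obtain ⟨P, p, hPX, hP, hpP, hpadj⟩ := aux_rep G X hX
  obtain ⟨Q, q, hQY, hQ, hqQ, hqadj⟩ := aux_rep G Y hY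
  have hXYd : ∀ v ∈ X, v ∉ Y := fun v hv => Set.disjoint_left.1 hXY hv
  have hd : Disjoint P Q := Finset.disjoint_left.2 fun v h h' => hXYd v (hPX v h) (hQY v h')
  -- clique-freeness of an induced subgraph
  have free : ∀ (U : Set V) (n : ℕ), (G.induce U).CliqueFree (n + 1) →
      ∀ K : Finset V, (∀ v ∈ K, v ∈ U) → G.IsClique (K : Set V) → K.card ≤ n := by
    intro U n h K hK hc
    by_contra hn
    obtain ⟨L, hLK, hL⟩ := Finset.exists_subset_card_eq (show n + 1 ≤ K.card by omega)
    refine h (L.subtype (· ∈ U)) ⟨?_, ?_⟩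
    · intro u hu v hv huv
      simp only [Finset.mem_coe, Finset.mem_subtype] at hu hv
      exact hc (hLK hu) (hLK hv) (fun h => huv (Subtype.ext h))
    · rw [Finset.card_subtype, Finset.filter_true_of_mem (fun v hv => hK v (hLK hv)), hL]
  have hk : ∀ K : Finset V, (∀ v ∈ K, v ∈ P ∨ v ∈ Q) → G.IsClique (K : Set V) →
      K.card ≤ k + 1 := fun K hK hc =>
    free (X ∪ Y) (k + 1) hXYfree K (fun v hv => (hK v hv).imp (hPX v) (hQY v)) hc
  have h2 : ∀ K : Finset V, (∀ v ∈ K, v ∈ P ∨ v ∈ Q) → G.IsClique (K : Set V) →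
      K.card = k + 1 → ∃ a ∈ K, ∃ b ∈ K, a ∈ P ∧ b ∈ P ∧ a ≠ b := by
    intro K hK hc hn
    have hsp : K.card = (K ∩ P).card + (K ∩ Q).card := by
      rw [← Finset.card_union_of_disjoint
        (hd.mono Finset.inter_subset_right Finset.inter_subset_right)]
      congr 1
      ext v
      simp only [Finset.mem_union, Finset.mem_inter]
      have := hK v
      tauto
    have hYk := free Y k hYfree (K ∩ Q) (fun v hv => hQY v (Finset.mem_inter.1 hv).2)
      (fun u hu v hv huv => hc (Finset.mem_inter.1 hu).1 (Finset.mem_inter.1 hv).1 huv)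
    have hne : (K ∩ P).card ≠ 1 := by
      intro h1
      apply hXYr
      refine ⟨K, ⟨hc, hn⟩, ?_, ?_⟩
      · rw [show (K : Set V) ∩ X = ((K ∩ P : Finset V) : Set V) from ?_, Set.ncard_coe_finset, h1]
        ext v
        simp only [Set.mem_inter_iff, Finset.mem_coe, Finset.mem_inter]
        have := hK v; have := hPX v; have := hQY v; have := hXYd v
        tauto
      · rw [show (K : Set V) ∩ Y = ((K ∩ Q : Finset V) : Set V) from ?_, Set.ncard_coe_finset]
        · omega
        ext v
        simp only [Set.mem_inter_iff, Finset.mem_coe, Finset.mem_inter]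
        have := hK v; have := hPX v; have := hQY v; have := hXYd v
        tauto
    obtain ⟨a, ha, b, hb, hab⟩ := Finset.one_lt_card.1 (show 1 < (K ∩ P).card by omega)
    rw [Finset.mem_inter] at ha hb
    exact ⟨a, ha.1, b, hb.1, ha.2, hb.2, hab⟩
  -- pulling back a coloring
  have pull : ∀ (P' : Finset V), P' ⊆ P → (∀ K : Finset V, (∀ v ∈ K, v ∈ P' ∨ v ∈ Q) →
      G.IsClique (K : Set V) → K.card ≤ k) →
      (G.induce ({x | x ∈ X ∧ p x ∈ P'} ∪ Y)).chromaticNumber ≤ (k : ℕ∞) := by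
    intro P' hP' hK
    have hcol := aux_color G P' Q k (fun u hu v hv => hP (hP' hu) (hP' hv)) hQ
      (hd.mono_left hP') hK
    let m : V → V := fun v => if v ∈ X then p v else q v
    have hm : ∀ v ∈ {x | x ∈ X ∧ p x ∈ P'} ∪ Y, m v ∈ {v | v ∈ P' ∨ v ∈ Q} := by
      rintro v (hv | hv)
      · simp only [m, if_pos hv.1]
        exact Or.inl hv.2
      · have : v ∉ X := fun h => hXYd v h hv
        simp only [m, if_neg this]
        exact Or.inr (hqQ v hv)
    have hadj : ∀ v ∈ {x | x ∈ X ∧ p x ∈ P'} ∪ Y, ∀ w, G.Adj v w ↔ G.Adj (m v) w := by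
      rintro v (hv | hv) w
      · simp only [m, if_pos hv.1]
        exact hpadj v hv.1 w
      · have : v ∉ X := fun h => hXYd v h hv
        simp only [m, if_neg this]
        exact hqadj v hv w
    let φ : G.induce ({x | x ∈ X ∧ p x ∈ P'} ∪ Y) →g G.induce {v | v ∈ P' ∨ v ∈ Q} :=
      { toFun := fun v => ⟨m v.1, hm v.1 v.2⟩
        map_rel' := by
          intro u v huv
          have h : G.Adj u.1 v.1 := huv
          have h1 := (hadj _ u.2 _).1 h
          exact ((hadj _ v.2 _).1 h1.symm).symm }
    exact (hcol.of_hom φ).chromaticNumber_le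
  by_cases hex : ∃ K : Finset V, (∀ v ∈ K, v ∈ P ∨ v ∈ Q) ∧ G.IsClique (K : Set V) ∧
      K.card = k + 1
  · obtain ⟨a, haP, b, hbP, hab, hall⟩ := aux_hit G P Q k hP hQ hd hk h2 hex
    have fin : ∀ c ∈ P, (∀ K : Finset V, (∀ v ∈ K, v ∈ P ∨ v ∈ Q) →
        G.IsClique (K : Set V) → K.card = k + 1 → c ∈ K) →
        2 * {x | x ∈ X ∧ p x = c}.ncard ≤ X.ncard →
        ∃ S ⊆ X ∪ Y, X.ncard + 2 * Y.ncard ≤ 2 * S.ncard ∧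
          (G.induce S).chromaticNumber ≤ (k : ℕ∞) := by
      intro c hc hcK hw
      refine ⟨{x | x ∈ X ∧ p x ∈ P.erase c} ∪ Y,
        Set.union_subset_union_left _ (fun x hx => hx.1), ?_, ?_⟩
      · rw [Set.ncard_union_eq (hXY.mono_left (fun x hx => hx.1))]
        have : X.ncard = {x | x ∈ X ∧ p x ∈ P.erase c}.ncard + {x | x ∈ X ∧ p x = c}.ncard := by
          rw [← Set.ncard_union_eq]
          · congr 1
            ext x
            simp only [Set.mem_union, Set.mem_ofPred_eq, Finset.mem_erase]
            have := hpP x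
            tauto
          · rw [Set.disjoint_left]
            intro x hx hx'
            exact (Finset.mem_erase.1 hx.2).1 hx'.2
        omega
      · apply pull _ (Finset.erase_subset _ _)
        intro K hK hKc
        have hK' : ∀ v ∈ K, v ∈ P ∨ v ∈ Q := fun v hv =>
          (hK v hv).imp_left Finset.mem_of_mem_erase
        have h1 := hk K hK' hKc
        have h3 : K.card ≠ k + 1 := by
          intro h
          rcases hK c (hcK K hK' hKc h) with h' | h'
          · exact (Finset.mem_erase.1 h').1 rfl
          · exact Finset.disjoint_left.1 hd hc h'
        omega
    have hsum : {x | x ∈ X ∧ p x = a}.ncard + {x | x ∈ X ∧ p x = b}.ncard ≤ X.ncard := by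
      rw [← Set.ncard_union_eq]
      · refine Set.ncard_le_ncard ?_ (Set.toFinite _)
        rintro x (hx | hx) <;> exact hx.1
      · rw [Set.disjoint_left]
        intro x hx hx'
        exact hab (hx.2.symm.trans hx'.2)
    rcases le_total {x | x ∈ X ∧ p x = a}.ncard {x | x ∈ X ∧ p x = b}.ncard with h | h
    · exact fin a haP (fun K h1 h2 h3 => (hall K h1 h2 h3).1) (by omega)
    · exact fin b hbP (fun K h1 h2 h3 => (hall K h1 h2 h3).2) (by omega)
  · refine ⟨{x | x ∈ X ∧ p x ∈ P} ∪ Y,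
        Set.union_subset_union_left _ (fun x hx => hx.1), ?_, ?_⟩
    · have : {x | x ∈ X ∧ p x ∈ P} = X := by
        ext x
        have := hpP x
        simp only [Set.mem_ofPred_eq]
        tauto
      rw [this, Set.ncard_union_eq hXY]
      omega
    · apply pull P (Finset.Subset.refl _)
      intro K hK hKc
      have h1 := hk K hK hKc
      have h3 : K.card ≠ k + 1 := fun h => hex ⟨K, hK, hKc, h⟩
      omega
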